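/- Let f ≥ 1 and let A be a nonempty subset of Fin (f+1). For every natural number t with 1 ≤ t ≤ f+1, the number N of permutations σ of Fin (f+1) such that σ(i) ∉ A for all indices i < t satisfies N · (f+1)^t ≤ f^t · (f+1)!. Equivalently, for Π a uniformly random permutation of Fin (f+1), Pr[Π(0) ∉ A ∧ ⋯ ∧ Π(t−1) ∉ A] ≤ β^{−t} with β = (f+1)/f > 1. -/

import Mathlib

open Finset

theorem aux_bern (f t : ℕ) :
    ((f : ℤ) + 1 - t) * ((f : ℤ) + 1) ^ t ≤ (f : ℤ) ^ t * (f + 1) := by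
  induction t with
  | zero => simp
  | succ t ih =>
    have h1 : (f : ℤ) * (((f : ℤ) + 1 - t) * ((f : ℤ) + 1) ^ t) ≤ f * ((f : ℤ) ^ t * (f + 1)) :=
      mul_le_mul_of_nonneg_left ih (by positivity)
    have h2 : (0 : ℤ) ≤ t * ((f : ℤ) + 1) ^ t := by positivity
    push_cast
    rw [pow_succ, pow_succ]
    nlinarith

theorem aux_fiber (f : ℕ) (a i j : Fin (f + 1)) :
    (Finset.univ.filter (fun σ : Equiv.Perm (Fin (f + 1)) => σ i = a)).card
      = (Finset.univ.filter (fun σ : Equiv.Perm (Fin (f + 1)) => σ j = a)).card := by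
  apply Finset.card_bij (fun σ _ => σ * Equiv.swap i j)
  · intro σ h
    simpa using h
  · intro σ _ τ _ h
    exact mul_right_cancel h
  · intro σ h
    refine ⟨σ * Equiv.swap i j, by simpa using h, ?_⟩
    simp [mul_assoc]

theorem aux_total (f : ℕ) (a i : Fin (f + 1)) :
    (f + 1) * (Finset.univ.filter (fun σ : Equiv.Perm (Fin (f + 1)) => σ i = a)).card
      = Nat.factorial (f + 1) := by
  have h := Finset.card_eq_sum_card_fiberwise
    (s := (Finset.univ : Finset (Equiv.Perm (Fin (f + 1)))))
    (t := (Finset.univ : Finset (Fin (f + 1)))) (f := fun σ => σ.symm a) (by intro x; simp)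
  rw [Finset.card_univ, Fintype.card_perm, Fintype.card_fin] at h
  rw [h, Finset.sum_congr rfl (g := fun _ =>
    (Finset.univ.filter (fun σ : Equiv.Perm (Fin (f + 1)) => σ i = a)).card)]
  · simp
  · intro k _
    rw [aux_fiber f a i k]
    congr 1
    ext σ
    simp only [Finset.mem_filter, Finset.mem_univ, true_and, Equiv.symm_apply_eq]
    exact eq_comm

theorem aux_count (f : ℕ) (A : Finset (Fin (f + 1))) (hA : A.Nonempty)
    (t : ℕ) (ht2 : t ≤ f + 1) :
    (Finset.univ.filter
        (fun σ : Equiv.Perm (Fin (f + 1)) =>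
          ∀ i : Fin (f + 1), (i : ℕ) < t → σ i ∉ A)).card * (f + 1)
      ≤ (f + 1 - t) * Nat.factorial (f + 1) := by
  obtain ⟨a, ha⟩ := hA
  set c := (Finset.univ.filter (fun σ : Equiv.Perm (Fin (f + 1)) => σ 0 = a)).card with hc
  have h1 : (Finset.univ.filter
        (fun σ : Equiv.Perm (Fin (f + 1)) =>
          ∀ i : Fin (f + 1), (i : ℕ) < t → σ i ∉ A)).card ≤ (f + 1 - t) * c := by
    have hcard : (Finset.univ.filter (fun i : Fin (f + 1) => ¬ (i : ℕ) < t)).card = f + 1 - t := by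
      have e := Finset.card_filter_add_card_filter_not (s := (Finset.univ : Finset (Fin (f + 1))))
        (fun i : Fin (f + 1) => (i : ℕ) < t)
      have e2 : (Finset.univ.filter (fun i : Fin (f + 1) => (i : ℕ) < t)).card = t := by
        rw [Fin.card_filter_val_lt]; omega
      simp only [Finset.card_univ, Fintype.card_fin] at e
      omega
    rw [← hcard]
    refine le_trans (Finset.card_le_card ?_) (Finset.card_biUnion_le_card_mul
      (Finset.univ.filter (fun i : Fin (f + 1) => ¬ (i : ℕ) < t))
      (fun i => Finset.univ.filter (fun σ : Equiv.Perm (Fin (f + 1)) => σ i = a)) c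
      (fun i _ => (aux_fiber f a i 0).le))
    intro σ hσ
    simp only [Finset.mem_filter, Finset.mem_univ, true_and, Finset.mem_biUnion] at hσ ⊢
    exact ⟨σ.symm a, fun h => hσ _ h (by simpa using ha), by simp⟩
  calc _ ≤ (f + 1 - t) * c * (f + 1) := Nat.mul_le_mul_right _ h1
    _ = (f + 1 - t) * ((f + 1) * c) := by ring
    _ = _ := by rw [hc, aux_total]

/-- Lemma 3 (third bullet): for a nonempty set `A` of the `f+1` selected parties
and `1 ≤ t ≤ f+1`, the number `N` of permutations of `Fin (f+1)` whose first `t`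
values avoid `A` satisfies `N·(f+1)^t ≤ f^t·(f+1)!`; equivalently, for a
uniformly random permutation `Π`, `Pr[Π(0) ∉ A ∧ ⋯ ∧ Π(t−1) ∉ A] ≤ β^{−t}`
with `β = (f+1)/f > 1`. -/
theorem random_order_avoidance_probability (f : ℕ) (hf : 1 ≤ f)
    (A : Finset (Fin (f + 1))) (hA : A.Nonempty)
    (t : ℕ) (ht1 : 1 ≤ t) (ht2 : t ≤ f + 1) :
    (Finset.univ.filter
        (fun σ : Equiv.Perm (Fin (f + 1)) =>
          ∀ i : Fin (f + 1), (i : ℕ) < t → σ i ∉ A)).card * (f + 1) ^ t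
      ≤ f ^ t * Nat.factorial (f + 1) ∧
    ((Finset.univ.filter
        (fun σ : Equiv.Perm (Fin (f + 1)) =>
          ∀ i : Fin (f + 1), (i : ℕ) < t → σ i ∉ A)).card : ℚ)
        / (Nat.factorial (f + 1) : ℚ)
      ≤ (((f : ℚ) + 1) / (f : ℚ))⁻¹ ^ t := by
  have key := aux_count f A hA t ht2
  generalize (Finset.univ.filter
        (fun σ : Equiv.Perm (Fin (f + 1)) =>
          ∀ i : Fin (f + 1), (i : ℕ) < t → σ i ∉ A)).card = N at key ⊢
  have hb : (f + 1 - t) * (f + 1) ^ t ≤ f ^ t * (f + 1) := by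
    have := aux_bern f t
    zify [ht2]
    exact this
  have main : N * (f + 1) ^ t ≤ f ^ t * Nat.factorial (f + 1) := by
    refine Nat.le_of_mul_le_mul_right (c := f + 1) ?_ (Nat.succ_pos f)
    calc N * (f + 1) ^ t * (f + 1) = N * (f + 1) * (f + 1) ^ t := by ring
      _ ≤ (f + 1 - t) * Nat.factorial (f + 1) * (f + 1) ^ t := Nat.mul_le_mul_right _ key
      _ = (f + 1 - t) * (f + 1) ^ t * Nat.factorial (f + 1) := by ring
      _ ≤ f ^ t * (f + 1) * Nat.factorial (f + 1) := Nat.mul_le_mul_right _ hb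
      _ = _ := by ring
  refine ⟨main, ?_⟩
  have hF : (0 : ℚ) < (Nat.factorial (f + 1) : ℚ) := by exact_mod_cast Nat.factorial_pos _
  rw [inv_div, div_pow, div_le_div_iff₀ hF (by positivity)]
  exact_mod_cast main
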